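/- arXiv:1103.1013 — 3 statements merged into one kernel-verified Lean document; each statement's English description precedes it below -/
import Mathlib

section
/- Weak duality for the group-feature-selection multiple-kernel problem (Proposition 1, weak direction): let w_1,…,w_T ∈ ℝ^m and ξ ≥ 0 satisfy the primal constraints ξ ≥ b_{ȳ'} − Σ_{t=1}^T ⟨w_t, a^t_{ȳ'}⟩ for every ȳ' ∈ Ȳ∖{ȳ}, and let α : Ȳ∖{ȳ} → ℝ satisfy α_{ȳ'} ≥ 0 for all ȳ' and Σ_{ȳ'} α_{ȳ'} ≤ C. Then (1/2)·(Σ_{t=1}^T ‖w_t‖₂)² + C·ξ ≥ Σ_{ȳ'∈Ȳ∖{ȳ}} α_{ȳ'}·b_{ȳ'} − (1/2)·max_{1≤t≤T} ‖Σ_{ȳ'∈Ȳ∖{ȳ}} α_{ȳ'}·a^t_{ȳ'}‖₂². -/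
open Finset

noncomputable section

/-- Euclidean inner product on `Fin m → ℝ`. -/
def inn {m : ℕ} (u v : Fin m → ℝ) : ℝ := ∑ j, u j * v j

/-- Euclidean norm on `Fin m → ℝ`. -/
def euclNorm {m : ℕ} (v : Fin m → ℝ) : ℝ := Real.sqrt (∑ j, (v j) ^ 2)

/-- The vector `a^t_{ȳ'} = (1/n) ∑ᵢ (yᵢ - y'ᵢ) (xᵢ ⊙ d)`. -/
def avec {n m : ℕ} (x : Fin n → Fin m → ℝ) (y : Fin n → ℝ) (d : Fin m → ℝ)
    (y' : Fin n → ℝ) : Fin m → ℝ :=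
  fun j => (1 / (n : ℝ)) * ∑ i, (y i - y' i) * (x i j * d j)

lemma inn_le_euclNorm_mul {m : ℕ} (u v : Fin m → ℝ) : inn u v ≤ euclNorm u * euclNorm v :=
  Real.sum_mul_le_sqrt_mul_sqrt univ u v

lemma euclNorm_nonneg {m : ℕ} (v : Fin m → ℝ) : 0 ≤ euclNorm v :=
  Real.sqrt_nonneg _

lemma inn_sum_smul {m : ℕ} {ι : Type*} (s : Finset ι) (u : Fin m → ℝ) (c : ι → ℝ)
    (v : ι → Fin m → ℝ) :
    inn u (fun j => ∑ i ∈ s, c i * v i j) = ∑ i ∈ s, c i * inn u (v i) := by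
  simp only [inn, Finset.mul_sum]
  rw [Finset.sum_comm]
  exact Finset.sum_congr rfl fun i _ => Finset.sum_congr rfl fun j _ => by ring

/-- Duality of the mixed norms: the pairing of two families of vectors is controlled by the sum
of the norms of one and any bound on the squared norms of the other. -/
lemma sum_inn_le_half_sq_add {m : ℕ} {ι : Type*} (s : Finset ι) (w v : ι → Fin m → ℝ) {M : ℝ}
    (hM : 0 ≤ M) (hv : ∀ t ∈ s, euclNorm (v t) ^ 2 ≤ M) :
    ∑ t ∈ s, inn (w t) (v t) ≤ (1 / 2) * (∑ t ∈ s, euclNorm (w t)) ^ 2 + (1 / 2) * M := by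
  have h : ∑ t ∈ s, inn (w t) (v t) ≤ (∑ t ∈ s, euclNorm (w t)) * √M := by
    rw [Finset.sum_mul]
    exact Finset.sum_le_sum fun t ht => (inn_le_euclNorm_mul _ _).trans <|
      mul_le_mul_of_nonneg_left (Real.le_sqrt_of_sq_le (hv t ht)) (euclNorm_nonneg _)
  nlinarith [sq_nonneg ((∑ t ∈ s, euclNorm (w t)) - √M), Real.sq_sqrt hM]

/-- Weak duality for the group-feature-selection multiple-kernel problem
(Proposition 1, weak direction). -/
theorem weak_duality_group_mkl
    (n m T : ℕ) (hn : 0 < n) (hm : 0 < m) (hT : 0 < T)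
    (C : ℝ) (hC : 0 < C)
    (x : Fin n → Fin m → ℝ)
    (y : Fin n → ℝ) (hy : ∀ i, y i = 1 ∨ y i = -1)
    (Y : Finset (Fin n → ℝ)) (hyY : y ∈ Y)
    (hYpm : ∀ y' ∈ Y, ∀ i, y' i = 1 ∨ y' i = -1)
    (hYne : (Y.erase y).Nonempty)
    (Δ : (Fin n → ℝ) → (Fin n → ℝ) → ℝ)
    (d : Fin T → Fin m → ℝ) (hd : ∀ t j, d t j = 0 ∨ d t j = 1)
    (w : Fin T → Fin m → ℝ) (ξ : ℝ) (hξ : 0 ≤ ξ)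
    (hfeas : ∀ y' ∈ Y.erase y,
      ξ ≥ Δ y y' / n - ∑ t, inn (w t) (avec x y (d t) y'))
    (α : (Fin n → ℝ) → ℝ)
    (hα : ∀ y' ∈ Y.erase y, 0 ≤ α y')
    (hαsum : ∑ y' ∈ Y.erase y, α y' ≤ C) :
    (1 / 2) * (∑ t, euclNorm (w t)) ^ 2 + C * ξ ≥
      (∑ y' ∈ Y.erase y, α y' * (Δ y y' / n)) -
      (1 / 2) * (Finset.univ.sup' (Finset.univ_nonempty_iff.mpr ⟨⟨0, hT⟩⟩)
        (fun t => euclNorm (fun j => ∑ y' ∈ Y.erase y, α y' * avec x y (d t) y' j) ^ 2)) := by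
  set v : Fin T → Fin m → ℝ := fun t j => ∑ y' ∈ Y.erase y, α y' * avec x y (d t) y' j with hv
  set M := Finset.univ.sup' (Finset.univ_nonempty_iff.mpr ⟨⟨0, hT⟩⟩)
    (fun t => euclNorm (v t) ^ 2)
  have hvM : ∀ t ∈ univ, euclNorm (v t) ^ 2 ≤ M := fun t ht =>
    Finset.le_sup' (fun t => euclNorm (v t) ^ 2) ht
  have hM0 : 0 ≤ M := (sq_nonneg _).trans (hvM ⟨0, hT⟩ (mem_univ _))
  have hpair : ∑ t, inn (w t) (v t) =
      ∑ y' ∈ Y.erase y, α y' * ∑ t, inn (w t) (avec x y (d t) y') := by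
    simp only [hv, inn_sum_smul, Finset.mul_sum]
    exact Finset.sum_comm
  have hdual : ∑ y' ∈ Y.erase y, α y' * (Δ y y' / n) ≤
      (∑ y' ∈ Y.erase y, α y') * ξ + ∑ t, inn (w t) (v t) := by
    rw [hpair, Finset.sum_mul, ← Finset.sum_add_distrib]
    refine Finset.sum_le_sum fun y' hy' => ?_
    rw [← mul_add]
    exact mul_le_mul_of_nonneg_left (by linarith [hfeas y' hy']) (hα y' hy')
  have hslack := mul_le_mul_of_nonneg_right hαsum hξ
  have hnorm := sum_inn_le_half_sq_add univ w v hM0 hvM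
  linarith
end
end

section
/- Weak duality for the bundle subproblem and its QCQP dual (Corollary 1, weak direction): let p^1,…,p^K with each p^k = (p^k_1,…,p^k_T) ∈ (ℝ^m)^T and reals q^1,…,q^K be given. Let w_1,…,w_T ∈ ℝ^m and ξ ≥ 0 satisfy ξ ≥ Σ_{t=1}^T ⟨w_t, p^k_t⟩ + q^k for every k = 1,…,K, and let α_1,…,α_K ≥ 0 with Σ_{k=1}^K α_k ≤ C and θ ∈ ℝ satisfy (1/2)·‖Σ_{k=1}^K α_k·p^k_t‖₂² ≤ θ for every t = 1,…,T. Then (1/2)·(Σ_{t=1}^T ‖w_t‖₂)² + C·ξ ≥ −θ + Σ_{k=1}^K α_k·q^k. -/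
open Finset

noncomputable section

/-- Lower Cauchy-Schwarz bound. -/
lemma neg_euclNorm_mul_le_inn {m : ℕ} (u v : Fin m → ℝ) :
    -(euclNorm u * euclNorm v) ≤ inn u v := by
  have h := Real.sum_mul_le_sqrt_mul_sqrt univ (fun j => -u j) v
  simp only [neg_mul, sum_neg_distrib, neg_sq] at h
  unfold inn euclNorm
  linarith

lemma sum_mul_sum_inn {ι τ : Type*} [Fintype ι] [Fintype τ] {m : ℕ}
    (α : ι → ℝ) (p : ι → τ → Fin m → ℝ) (w : τ → Fin m → ℝ) :
    ∑ k, α k * ∑ t, inn (w t) (p k t) = ∑ t, inn (w t) (fun j => ∑ k, α k * p k t j) := by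
  simp only [inn, mul_sum]
  rw [sum_comm]
  refine sum_congr rfl fun t _ => ?_
  rw [sum_comm]
  exact sum_congr rfl fun j _ => sum_congr rfl fun k _ => by ring

/-- Weak duality for the bundle subproblem and its QCQP dual
(Corollary 1, weak direction). -/
theorem weak_duality_bundle_qcqp
    (m T K : ℕ) (hm : 0 < m) (hT : 0 < T) (hK : 0 < K)
    (C : ℝ) (hC : 0 < C)
    (p : Fin K → Fin T → Fin m → ℝ) (q : Fin K → ℝ)
    (w : Fin T → Fin m → ℝ) (ξ : ℝ) (hξ : 0 ≤ ξ)
    (hfeas : ∀ k, ξ ≥ ∑ t, inn (w t) (p k t) + q k)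
    (α : Fin K → ℝ) (hα : ∀ k, 0 ≤ α k) (hαsum : ∑ k, α k ≤ C)
    (θ : ℝ)
    (hθ : ∀ t, (1 / 2) * euclNorm (fun j => ∑ k, α k * p k t j) ^ 2 ≤ θ) :
    (1 / 2) * (∑ t, euclNorm (w t)) ^ 2 + C * ξ ≥ -θ + ∑ k, α k * q k := by
  have hθ0 : 0 ≤ θ := le_trans (by positivity) (hθ ⟨0, hT⟩)
  have hP (t : Fin T) : euclNorm (fun j => ∑ k, α k * p k t j) ≤ √(2 * θ) :=
    Real.le_sqrt_of_sq_le (by linarith [hθ t])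
  have hinn : -((∑ t, euclNorm (w t)) * √(2 * θ)) ≤ ∑ k, α k * ∑ t, inn (w t) (p k t) := by
    rw [sum_mul_sum_inn, sum_mul, ← sum_neg_distrib]
    refine sum_le_sum fun t _ => le_trans ?_ (neg_euclNorm_mul_le_inn _ _)
    exact neg_le_neg (mul_le_mul_of_nonneg_left (hP t) (euclNorm_nonneg _))
  have hsum : ∑ k, α k * ∑ t, inn (w t) (p k t) + ∑ k, α k * q k ≤ C * ξ := by
    rw [← sum_add_distrib]
    calc ∑ k, (α k * ∑ t, inn (w t) (p k t) + α k * q k)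
        ≤ ∑ k, α k * ξ := sum_le_sum fun k _ => by
          rw [← mul_add]
          exact mul_le_mul_of_nonneg_left (hfeas k) (hα k)
      _ = (∑ k, α k) * ξ := (sum_mul ..).symm
      _ ≤ C * ξ := mul_le_mul_of_nonneg_right hαsum hξ
  have hsq : √(2 * θ) ^ 2 = 2 * θ := Real.sq_sqrt (by positivity)
  linarith [sq_nonneg (∑ t, euclNorm (w t) - √(2 * θ)),
    sub_sq (∑ t, euclNorm (w t)) √(2 * θ)]
end
end

section
/- Zero duality gap at a KKT point for the bundle subproblem and its QCQP dual (Corollary 1, optimality direction): let p^1,…,p^K with each p^k = (p^k_1,…,p^k_T) ∈ (ℝ^m)^T and reals q^1,…,q^K be given. Let w_1,…,w_T ∈ ℝ^m and ξ ≥ 0 satisfy ξ ≥ Σ_{t=1}^T ⟨w_t, p^k_t⟩ + q^k for every k; let α_1,…,α_K ≥ 0 with Σ_k α_k ≤ C and μ_1,…,μ_T ≥ 0 with Σ_t μ_t = 1. Set u_t = −Σ_{k=1}^K α_k·p^k_t and θ = (1/2)·max_{1≤t≤T} ‖u_t‖₂². Assume (i) w_t = μ_t·u_t for every t, (ii) for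 every k with α_k > 0 one has ξ = Σ_{t=1}^T ⟨w_t, p^k_t⟩ + q^k, (iii) for every t with μ_t > 0 one has ‖u_t‖₂² = max_{1≤s≤T} ‖u_s‖₂², and (iv) ξ·(C − Σ_k α_k) = 0. Then (1/2)·(Σ_{t=1}^T ‖w_t‖₂)² + C·ξ = −θ + Σ_{k=1}^K α_k·q^k, and consequently (w_1,…,w_T, ξ) minimizes (1/2)·(Σ_t ‖w_t‖₂)² + C·ξ over all (w'_1,…,w'_T, ξ') with ξ' ≥ 0 and ξ' ≥ Σ_t ⟨w'_t, p^k_t⟩ + q^k for every k. -/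
open Finset

noncomputable section

lemma inn_self {m : ℕ} (v : Fin m → ℝ) : inn v v = euclNorm v ^ 2 := by
  unfold inn euclNorm
  rw [Real.sq_sqrt (Finset.sum_nonneg fun j _ => sq_nonneg (v j))]
  exact Finset.sum_congr rfl fun j _ => (sq (v j)).symm

lemma inn_le_euclNorm_mul_euclNorm {m : ℕ} (v w : Fin m → ℝ) :
    inn v w ≤ euclNorm v * euclNorm w :=
  Real.sum_mul_le_sqrt_mul_sqrt _ _ _

lemma inn_smul_left {m : ℕ} (c : ℝ) (v w : Fin m → ℝ) :
    inn (fun j => c * v j) w = c * inn v w := by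
  simp only [inn, Finset.mul_sum, mul_assoc]

lemma euclNorm_smul {m : ℕ} {c : ℝ} (hc : 0 ≤ c) (v : Fin m → ℝ) :
    euclNorm (fun j => c * v j) = c * euclNorm v := by
  simp only [euclNorm, mul_pow, ← Finset.mul_sum]
  rw [Real.sqrt_mul (sq_nonneg c), Real.sqrt_sq hc]

/-- Pairing with the negative aggregate of the cutting planes. -/
lemma sum_mul_sum_inn_eq_neg_sum_inn {m T K : ℕ} (p : Fin K → Fin T → Fin m → ℝ)
    (α : Fin K → ℝ) (u : Fin T → Fin m → ℝ) (hu : ∀ t j, u t j = -∑ k, α k * p k t j)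
    (w : Fin T → Fin m → ℝ) :
    ∑ k, α k * ∑ t, inn (w t) (p k t) = -∑ t, inn (w t) (u t) := by
  simp only [inn, hu, mul_neg, Finset.sum_neg_distrib, neg_neg, Finset.mul_sum]
  rw [Finset.sum_comm]
  refine Finset.sum_congr rfl fun t _ => ?_
  rw [Finset.sum_comm]
  exact Finset.sum_congr rfl fun j _ => Finset.sum_congr rfl fun k _ => by ring

/-- The aggregated slack of the cutting-plane constraints. -/
lemma sum_mul_slack {m T K : ℕ} (p : Fin K → Fin T → Fin m → ℝ) (q : Fin K → ℝ)
    (α : Fin K → ℝ) (u : Fin T → Fin m → ℝ) (hu : ∀ t j, u t j = -∑ k, α k * p k t j)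
    (w : Fin T → Fin m → ℝ) (ξ : ℝ) :
    ∑ k, α k * (ξ - (∑ t, inn (w t) (p k t) + q k)) =
      ξ * ∑ k, α k + ∑ t, inn (w t) (u t) - ∑ k, α k * q k := by
  simp only [mul_sub, mul_add, Finset.sum_sub_distrib, Finset.sum_add_distrib,
    sum_mul_sum_inn_eq_neg_sum_inn p α u hu w, ← Finset.sum_mul]
  ring

/-- Zero duality gap at a KKT point for the bundle subproblem and its QCQP dual
(Corollary 1, optimality direction). -/
theorem zero_gap_bundle_qcqp
    (m T K : ℕ) (hm : 0 < m) (hT : 0 < T) (hK : 0 < K)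
    (C : ℝ) (hC : 0 < C)
    (p : Fin K → Fin T → Fin m → ℝ) (q : Fin K → ℝ)
    (w : Fin T → Fin m → ℝ) (ξ : ℝ) (hξ : 0 ≤ ξ)
    (hfeas : ∀ k, ξ ≥ ∑ t, inn (w t) (p k t) + q k)
    (α : Fin K → ℝ) (hα : ∀ k, 0 ≤ α k) (hαsum : ∑ k, α k ≤ C)
    (μ : Fin T → ℝ) (hμ : ∀ t, 0 ≤ μ t) (hμsum : ∑ t, μ t = 1)
    (u : Fin T → Fin m → ℝ)
    (hu : ∀ t j, u t j = -∑ k, α k * p k t j)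
    (θ : ℝ)
    (hθ : θ = (1 / 2) * Finset.univ.sup' (Finset.univ_nonempty_iff.mpr ⟨⟨0, hT⟩⟩)
      (fun t => euclNorm (u t) ^ 2))
    (hKKT1 : ∀ t, w t = fun j => μ t * u t j)
    (hKKT2 : ∀ k, 0 < α k → ξ = ∑ t, inn (w t) (p k t) + q k)
    (hKKT3 : ∀ t, 0 < μ t →
      euclNorm (u t) ^ 2 =
        Finset.univ.sup' (Finset.univ_nonempty_iff.mpr ⟨⟨0, hT⟩⟩)
          (fun s => euclNorm (u s) ^ 2))
    (hKKT4 : ξ * (C - ∑ k, α k) = 0) :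
    ((1 / 2) * (∑ t, euclNorm (w t)) ^ 2 + C * ξ = -θ + ∑ k, α k * q k) ∧
    (∀ (w' : Fin T → Fin m → ℝ) (ξ' : ℝ), 0 ≤ ξ' →
      (∀ k, ξ' ≥ ∑ t, inn (w' t) (p k t) + q k) →
      (1 / 2) * (∑ t, euclNorm (w t)) ^ 2 + C * ξ ≤
        (1 / 2) * (∑ t, euclNorm (w' t)) ^ 2 + C * ξ') := by
  obtain ⟨t₀, -, ht₀⟩ := Finset.exists_mem_eq_sup' (Finset.univ_nonempty_iff.mpr ⟨⟨0, hT⟩⟩)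
    (fun t => euclNorm (u t) ^ 2)
  have hmax : ∀ t, euclNorm (u t) ^ 2 ≤ euclNorm (u t₀) ^ 2 := fun t =>
    (Finset.le_sup' (fun t => euclNorm (u t) ^ 2) (Finset.mem_univ t)).trans_eq ht₀
  rw [ht₀] at hθ hKKT3
  set R := euclNorm (u t₀)
  have hR : 0 ≤ R := euclNorm_nonneg _
  have hμu : ∀ t, μ t * euclNorm (u t) = μ t * R := fun t => by
    rcases (hμ t).eq_or_lt with h | h
    · rw [← h, zero_mul, zero_mul]
    · rw [(sq_eq_sq₀ (euclNorm_nonneg _) hR).1 (hKKT3 t h)]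
  have hnorm : ∑ t, euclNorm (w t) = R := by
    simp only [hKKT1, euclNorm_smul (hμ _), hμu, ← Finset.sum_mul, hμsum, one_mul]
  have hinn : ∑ t, inn (w t) (u t) = R ^ 2 := by
    have h : ∀ t, inn (w t) (u t) = μ t * R ^ 2 := fun t => by
      rw [hKKT1, inn_smul_left, inn_self, sq, ← mul_assoc, hμu, mul_right_comm, hμu]
      ring
    simp only [h, ← Finset.sum_mul, hμsum, one_mul]
  have hslack : ∑ k, α k * (ξ - (∑ t, inn (w t) (p k t) + q k)) = 0 :=
    Finset.sum_eq_zero fun k _ => by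
      rcases (hα k).eq_or_lt with h | h
      · rw [← h, zero_mul]
      · rw [sub_eq_zero.2 (hKKT2 k h), mul_zero]
  rw [sum_mul_slack p q α u hu, hinn] at hslack
  have hgap : (1 / 2) * (∑ t, euclNorm (w t)) ^ 2 + C * ξ = -θ + ∑ k, α k * q k := by
    rw [hnorm, hθ]
    linarith
  refine ⟨hgap, fun w' ξ' hξ' hfeas' => ?_⟩
  rw [hgap, hθ]
  have hslack' : 0 ≤ ∑ k, α k * (ξ' - (∑ t, inn (w' t) (p k t) + q k)) :=
    Finset.sum_nonneg fun k _ => mul_nonneg (hα k) (sub_nonneg.2 (hfeas' k))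
  rw [sum_mul_slack p q α u hu] at hslack'
  have hinn' : ∑ t, inn (w' t) (u t) ≤ (∑ t, euclNorm (w' t)) * R := by
    rw [Finset.sum_mul]
    exact Finset.sum_le_sum fun t _ => (inn_le_euclNorm_mul_euclNorm _ _).trans
      (mul_le_mul_of_nonneg_left ((sq_le_sq₀ (euclNorm_nonneg _) hR).1 (hmax t)) (euclNorm_nonneg _))
  have hCξ' : ξ' * ∑ k, α k ≤ ξ' * C := mul_le_mul_of_nonneg_left hαsum hξ'
  linarith [sq_nonneg ((∑ t, euclNorm (w' t)) - R)]
end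
end
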